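/- With D the Subset Sum MDP of the context, built from positive integers s₁,…,sₙ and N ∈ ℕ with N ≤ T = s₁+⋯+sₙ: there exists a subset P ⊆ {1,…,n} with Σ_{i∈P} sᵢ = N if and only if there exists a memoryless strategy α such that the states s and t are probabilistic bisimilar in D(α). -/

import Mathlib

open Matrix

/-- A labelled Markov decision process: a partial probabilistic transition function
`phi : S × A ⇀ (S → ℝ)` and a labelling function. -/
structure MDP (S A L : Type) where
  phi : S → A → Option (S → ℝ)
  label : S → L

namespace MDP

variable {S A L : Type} [Fintype S] [Fintype A] [DecidableEq S]

/-- The MDP data is well-formed: every state has an available action, and every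
defined `phi s m` is a probability distribution on `S`. -/
def IsValid (D : MDP S A L) : Prop :=
  (∀ s, ∃ m, (D.phi s m).isSome) ∧
    ∀ s m d, D.phi s m = some d → (∀ t, 0 ≤ d t) ∧ (∑ t, d t) = 1

/-- Transition probabilities, with `0` for unavailable actions. -/
def trans (D : MDP S A L) (s : S) (m : A) : S → ℝ :=
  (D.phi s m).getD 0

/-- A memoryless strategy: for each state a probability distribution on the
available actions. -/
def IsStrategy (D : MDP S A L) (α : S → A → ℝ) : Prop :=
  ∀ s, (∀ m, 0 ≤ α s m) ∧ (∑ m, α s m) = 1 ∧ ∀ m, D.phi s m = none → α s m = 0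

/-- Transition probabilities of the induced labelled Markov chain `D(α)`. -/
def tau (D : MDP S A L) (α : S → A → ℝ) (s t : S) : ℝ :=
  ∑ m, α s m * D.trans s m t

/-- The matrix `M_α(a)`. -/
def Mmat [DecidableEq L] (D : MDP S A L) (α : S → A → ℝ) (a : L) : Matrix S S ℝ :=
  Matrix.of fun s t => if D.label s = a then D.tau α s t else 0

/-- The matrix `M_α(w)` for a word `w ∈ L*` (identity for the empty word). -/
def Mword [DecidableEq L] (D : MDP S A L) (α : S → A → ℝ) (w : List L) : Matrix S S ℝ :=
  (w.map (D.Mmat α)).prod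

/-- A memoryless deterministic (MD) strategy, viewed as a function `S → A`
choosing an available action in each state. -/
def IsMD (D : MDP S A L) (β : S → A) : Prop := ∀ s, (D.phi s (β s)).isSome

/-- The memoryless strategy corresponding to an MD strategy. -/
def mdStrat [DecidableEq A] (β : S → A) : S → A → ℝ :=
  fun s m => if m = β s then 1 else 0

end MDP

namespace MDP

variable {S A L : Type} [Fintype S] [Fintype A] [DecidableEq S]

open Classical in
/-- `τ(s)(E)`: the transition probability from `s` to the set `E ⊆ S` in the
labelled Markov chain `D(α)`. -/
noncomputable def tauE (D : MDP S A L) (α : S → A → ℝ) (s : S) (E : Set S) : ℝ :=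
  ∑ t, if t ∈ E then D.tau α s t else 0

/-- `R` is a probabilistic bisimulation in the labelled Markov chain `D(α)`:
an equivalence relation relating only equally labelled states with equal
transition probabilities into every `R`-equivalence class. -/
def IsProbBisim (D : MDP S A L) (α : S → A → ℝ) (R : S → S → Prop) : Prop :=
  Equivalence R ∧ ∀ s t, R s t →
    D.label s = D.label t ∧
      ∀ E : Set S, (∃ u, E = {v | R u v}) → D.tauE α s E = D.tauE α t E

/-- Probabilistic bisimilarity `∼_{D(α)}`: the largest probabilistic bisimulation,
i.e. `s ∼ t` iff some probabilistic bisimulation relates `s` and `t`. -/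
def Bisimilar (D : MDP S A L) (α : S → A → ℝ) (s t : S) : Prop :=
  ∃ R, D.IsProbBisim α R ∧ R s t

end MDP

/-- The Dirac distribution on a state. -/
def dirac {S : Type} [DecidableEq S] (x : S) : S → ℝ := fun y => if y = x then 1 else 0

/-- States of the Subset Sum MDP: `s, u₁,…,uₙ, s_a, s_b, t, t₁, t₂, t_a, t_b`. -/
inductive SubState (n : ℕ) where
  | s | u (i : Fin n) | sa | sb | t | t1 | t2 | ta | tb
deriving DecidableEq, Fintype

/-- The transition function of the Subset Sum MDP built from `s₁,…,sₙ` and `N`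
(with `T = s₁ + ⋯ + sₙ`); each `uᵢ` has two actions (`false` to `s_a`, `true` to
`s_b`), all other states a single action `false`. -/
noncomputable def subPhi (n : ℕ) (sv : Fin n → ℕ) (N : ℕ) :
    SubState n → Bool → Option (SubState n → ℝ) :=
  fun st act =>
    match st, act with
    | .s, false =>
        some fun x => match x with
          | .u i => (sv i : ℝ) / ((∑ k, sv k : ℕ) : ℝ)
          | _ => 0
    | .u _, false => some (dirac .sa)
    | .u _, true => some (dirac .sb)
    | .sa, false => some (dirac .s)
    | .sb, false => some (dirac .s)
    | .t, false =>
        some fun x => match x with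
          | .t1 => (N : ℝ) / ((∑ k, sv k : ℕ) : ℝ)
          | .t2 => 1 - (N : ℝ) / ((∑ k, sv k : ℕ) : ℝ)
          | _ => 0
    | .t1, false => some (dirac .ta)
    | .t2, false => some (dirac .tb)
    | .ta, false => some (dirac .t)
    | .tb, false => some (dirac .t)
    | _, _ => none

/-- The labelling function (labels from `Bool`, where `true` is the label `b`):
`s_b` and `t_b` carry label `b`, all other states label `a`. -/
def subLabel (n : ℕ) : SubState n → Bool
  | .sb => true
  | .tb => true
  | _ => false

/-- The Subset Sum MDP. -/
noncomputable def subMDP (n : ℕ) (sv : Fin n → ℕ) (N : ℕ) :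
    MDP (SubState n) Bool Bool :=
  ⟨subPhi n sv N, subLabel n⟩

namespace MDP

variable {S A L : Type} [Fintype A]

open Classical in
theorem tauE_eq_sum_of_tau_eq_sum_dirac [Fintype S] [DecidableEq S] {ι : Type}
    [Fintype ι] {D : MDP S A L} {α : S → A → ℝ} {x : S} {w : ι → ℝ} {g : ι → S}
    (h : ∀ y, D.tau α x y = ∑ j, w j * dirac (g j) y) (E : Set S) :
    D.tauE α x E = ∑ j, if g j ∈ E then w j else 0 := by
  have hterm : ∀ y, (if y ∈ E then D.tau α x y else 0) =
      ∑ j, if y = g j then (if g j ∈ E then w j else 0) else 0 := by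
    intro y
    rw [h y]
    split_ifs with hy
    · refine Finset.sum_congr rfl fun j _ => ?_
      unfold dirac
      split_ifs <;> simp_all
    · refine (Finset.sum_eq_zero fun j _ => ?_).symm
      split_ifs <;> simp_all
  rw [tauE, Finset.sum_congr rfl fun y _ => hterm y, Finset.sum_comm]
  simp

open Classical in
theorem tauE_of_tau_eq_dirac [Fintype S] [DecidableEq S] {D : MDP S A L} {α : S → A → ℝ}
    {x z : S} (h : ∀ y, D.tau α x y = dirac z y) (E : Set S) :
    D.tauE α x E = if z ∈ E then 1 else 0 := by
  simpa using tauE_eq_sum_of_tau_eq_sum_dirac (ι := Unit) (w := fun _ => 1) (g := fun _ => z)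
    (by simpa using h) E

theorem tau_eq_of_forall_ne_eq_none {D : MDP S A L} {α : S → A → ℝ} (hα : D.IsStrategy α)
    {x : S} {m : A} (hm : ∀ m', m' ≠ m → D.phi x m' = none) (y : S) :
    D.tau α x y = D.trans x m y := by
  obtain ⟨-, hsum, hnone⟩ := hα x
  have hzero : ∀ m', m' ≠ m → α x m' = 0 := fun m' h => hnone m' (hm m' h)
  have hone : α x m = 1 := by
    rw [← hsum, Finset.sum_eq_single m (fun m' _ h => hzero m' h) (by simp)]
  rw [tau, Finset.sum_eq_single m (fun m' _ h => by rw [hzero m' h, zero_mul]) (by simp), hone,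
    one_mul]

theorem isStrategy_mdStrat [DecidableEq A] {D : MDP S A L} {β : S → A} (hβ : D.IsMD β) :
    D.IsStrategy (mdStrat β) := by
  intro x
  refine ⟨fun m => ?_, by simp [mdStrat], fun m hm => ?_⟩
  · unfold mdStrat
    split_ifs <;> norm_num
  · have hne : m ≠ β x := by
      rintro rfl
      simpa [hm] using hβ x
    simp [mdStrat, hne]

end MDP

section SubsetSum

variable {n : ℕ} {sv : Fin n → ℕ} {N : ℕ} {α : SubState n → Bool → ℝ}

open Classical in
theorem subMDP_tauE_s (hα : (subMDP n sv N).IsStrategy α) (E : Set (SubState n)) :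
    (subMDP n sv N).tauE α .s E =
      ∑ i, if SubState.u i ∈ E then (sv i : ℝ) / ((∑ k, sv k : ℕ) : ℝ) else 0 := by
  refine MDP.tauE_eq_sum_of_tau_eq_sum_dirac (fun y => ?_) E
  rw [MDP.tau_eq_of_forall_ne_eq_none hα (m := false) (by simp [subMDP, subPhi])]
  cases y <;> simp [MDP.trans, subMDP, subPhi, dirac]

open Classical in
theorem subMDP_tauE_t (hα : (subMDP n sv N).IsStrategy α) (E : Set (SubState n)) :
    (subMDP n sv N).tauE α .t E =
      (if SubState.t1 ∈ E then (N : ℝ) / ((∑ k, sv k : ℕ) : ℝ) else 0) +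
        if SubState.t2 ∈ E then 1 - (N : ℝ) / ((∑ k, sv k : ℕ) : ℝ) else 0 := by
  have h := MDP.tauE_eq_sum_of_tau_eq_sum_dirac (ι := Bool) (D := subMDP n sv N) (α := α)
    (x := .t) (g := fun b => if b then .t1 else .t2)
    (w := fun b => if b then (N : ℝ) / ((∑ k, sv k : ℕ) : ℝ)
      else 1 - (N : ℝ) / ((∑ k, sv k : ℕ) : ℝ)) (fun y => ?_) E
  · simpa using h
  · rw [MDP.tau_eq_of_forall_ne_eq_none hα (m := false) (by simp [subMDP, subPhi])]
    cases y <;> simp [MDP.trans, subMDP, subPhi, dirac]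

theorem subMDP_tau_eq_dirac (hα : (subMDP n sv N).IsStrategy α) {x z : SubState n}
    (hfalse : subPhi n sv N x false = some (dirac z)) (htrue : subPhi n sv N x true = none)
    (y : SubState n) : (subMDP n sv N).tau α x y = dirac z y := by
  rw [MDP.tau_eq_of_forall_ne_eq_none hα (m := false) (by simpa [subMDP] using htrue)]
  simp [MDP.trans, subMDP, hfalse]

theorem exists_subset_sum_eq_of_bisimilar (hT : 0 < ∑ i, sv i)
    (hα : (subMDP n sv N).IsStrategy α) (h : (subMDP n sv N).Bisimilar α .s .t) :
    ∃ P : Finset (Fin n), ∑ i ∈ P, sv i = N := by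
  classical
  obtain ⟨R, ⟨hR, hbis⟩, hst⟩ := h
  have ht : ¬ R .t1 .t2 := by
    intro h12
    have hE := (hbis _ _ h12).2 _ ⟨.ta, rfl⟩
    rw [MDP.tauE_of_tau_eq_dirac (subMDP_tau_eq_dirac hα (x := .t1) rfl rfl),
      MDP.tauE_of_tau_eq_dirac (subMDP_tau_eq_dirac hα (x := .t2) rfl rfl)] at hE
    have hab : ¬ R .ta .tb := fun hab => by
      simpa [subMDP, subLabel] using (hbis _ _ hab).1
    simp [hab, hR.refl] at hE
  have hE := (hbis _ _ hst).2 _ ⟨.t1, rfl⟩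
  rw [subMDP_tauE_s hα, subMDP_tauE_t hα] at hE
  simp only [Set.mem_ofPred_eq, ht, hR.refl, if_true, if_false, add_zero] at hE
  have hT' : ((∑ k, sv k : ℕ) : ℝ) ≠ 0 := by exact_mod_cast hT.ne'
  refine ⟨Finset.univ.filter fun i => R .t1 (.u i), ?_⟩
  rw [← Finset.sum_filter, ← Finset.sum_div, div_left_inj' hT'] at hE
  exact_mod_cast hE

/-- The choice of `s_a` on `P` and `s_b` off `P`. -/
def subsetChoice (P : Finset (Fin n)) : SubState n → Bool
  | .u i => decide (i ∉ P)
  | _ => false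

/-- The classes of the bisimulation relating `uᵢ` to `t₁` if `i ∈ P` and to `t₂` otherwise. -/
def subsetClass (P : Finset (Fin n)) : SubState n → Fin 5
  | .s => 0
  | .t => 0
  | .u i => if i ∈ P then 1 else 2
  | .t1 => 1
  | .t2 => 2
  | .sa => 3
  | .ta => 3
  | .sb => 4
  | .tb => 4

theorem isMD_subsetChoice (P : Finset (Fin n)) : (subMDP n sv N).IsMD (subsetChoice P) := by
  intro x
  cases x with
  | u i => by_cases hi : i ∈ P <;> simp [subMDP, subPhi, subsetChoice, hi]
  | _ => simp [subMDP, subPhi, subsetChoice]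

theorem bisimilar_of_subset_sum_eq (hT : 0 < ∑ i, sv i) {P : Finset (Fin n)}
    (hP : ∑ i ∈ P, sv i = N) :
    (subMDP n sv N).Bisimilar (MDP.mdStrat (subsetChoice P)) .s .t := by
  classical
  have hα : (subMDP n sv N).IsStrategy (MDP.mdStrat (subsetChoice P)) :=
    MDP.isStrategy_mdStrat (isMD_subsetChoice P)
  have hu : ∀ i y, (subMDP n sv N).tau (MDP.mdStrat (subsetChoice P)) (.u i) y =
      dirac (if i ∈ P then .sa else .sb) y := by
    intro i y
    by_cases hi : i ∈ P <;>
      simp [MDP.tau, MDP.mdStrat, MDP.trans, subMDP, subPhi, subsetChoice, hi]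
  have hT' : ((∑ k, sv k : ℕ) : ℝ) ≠ 0 := by exact_mod_cast hT.ne'
  have hsum (c : Fin 5) :
      (∑ i, if c = (if i ∈ P then 1 else 2) then (sv i : ℝ) / ((∑ k, sv k : ℕ) : ℝ) else 0) =
        (if c = 1 then (N : ℝ) / ((∑ k, sv k : ℕ) : ℝ) else 0) +
          if c = 2 then 1 - (N : ℝ) / ((∑ k, sv k : ℕ) : ℝ) else 0 := by
    have hin : ∑ i, (if i ∈ P then (sv i : ℝ) / ((∑ k, sv k : ℕ) : ℝ) else 0) =
        (N : ℝ) / ((∑ k, sv k : ℕ) : ℝ) := by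
      rw [← hP, Finset.sum_ite_mem, Finset.univ_inter, ← Finset.sum_div, Nat.cast_sum P]
    have hall : ∑ i, (sv i : ℝ) / ((∑ k, sv k : ℕ) : ℝ) = 1 := by
      rw [← Finset.sum_div, ← Nat.cast_sum, div_self hT']
    by_cases h1 : c = 1
    · subst h1
      simp only [if_true, show (1 : Fin 5) ≠ 2 by decide, if_false, add_zero, ← hin]
      refine Finset.sum_congr rfl fun i _ => ?_
      by_cases hi : i ∈ P <;> simp [hi]
    by_cases h2 : c = 2
    · subst h2
      simp only [if_true, show (2 : Fin 5) ≠ 1 by decide, if_false, zero_add, ← hin]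
      rw [← hall, ← Finset.sum_sub_distrib]
      refine Finset.sum_congr rfl fun i _ => ?_
      by_cases hi : i ∈ P <;> simp [hi]
    · simp only [h1, h2, if_false, add_zero]
      refine Finset.sum_eq_zero fun i _ => ?_
      by_cases hi : i ∈ P <;> simp [hi, h1, h2]
  have hE (c : Fin 5) (x : SubState n) :
      (subMDP n sv N).tauE (MDP.mdStrat (subsetChoice P)) x {y | c = subsetClass P y} =
        match subsetClass P x with
        | 0 => (if c = 1 then (N : ℝ) / ((∑ k, sv k : ℕ) : ℝ) else 0) +
          if c = 2 then 1 - (N : ℝ) / ((∑ k, sv k : ℕ) : ℝ) else 0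
        | 1 => if c = 3 then 1 else 0
        | 2 => if c = 4 then 1 else 0
        | _ => if c = 0 then 1 else 0 := by
    cases x with
    | s =>
      rw [subMDP_tauE_s hα]
      refine Eq.trans (Finset.sum_congr rfl fun i _ => ?_) (hsum c)
      simp only [subsetClass, Set.mem_ofPred_eq]
      congr
    | t => simp [subMDP_tauE_t hα, subsetClass]
    | u i =>
      rw [MDP.tauE_of_tau_eq_dirac (hu i)]
      by_cases hi : i ∈ P <;> simp [subsetClass, hi]
    | t1 | t2 | sa | sb | ta | tb =>
      rw [MDP.tauE_of_tau_eq_dirac (subMDP_tau_eq_dirac hα (by rfl) (by rfl))]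
      simp only [subsetClass, Set.mem_ofPred_eq]
      congr
  have hlabel (x : SubState n) : subLabel n x = decide (subsetClass P x = 4) := by
    cases x with
    | u i => by_cases hi : i ∈ P <;> simp [subLabel, subsetClass, hi]
    | _ => simp [subLabel, subsetClass]
  refine ⟨fun x y => subsetClass P x = subsetClass P y,
    ⟨⟨fun _ => rfl, Eq.symm, Eq.trans⟩, fun x y hxy => ⟨?_, ?_⟩⟩, rfl⟩
  · change subLabel n x = subLabel n y
    rw [hlabel, hlabel, hxy]
  · rintro _ ⟨v, rfl⟩
    rw [hE, hE, hxy]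

end SubsetSum

/-- there is a subset `P ⊆ {1,…,n}` with `Σ_{i∈P} sᵢ = N` iff there
is a memoryless strategy `α` making `s` and `t` probabilistic bisimilar in `D(α)`. -/
theorem subsetSum_iff_exists_strategy_bisimilar
    (n : ℕ) (hn : 1 ≤ n) (sv : Fin n → ℕ) (hsv : ∀ i, 0 < sv i)
    (N : ℕ) (hN : N ≤ ∑ i, sv i) :
    (∃ P : Finset (Fin n), (∑ i ∈ P, sv i) = N) ↔
      ∃ α, (subMDP n sv N).IsStrategy α ∧
        (subMDP n sv N).Bisimilar α SubState.s SubState.t := by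
  have hT : 0 < ∑ i, sv i := Finset.sum_pos (fun i _ => hsv i) ⟨⟨0, hn⟩, Finset.mem_univ _⟩
  constructor
  · rintro ⟨P, hP⟩
    exact ⟨_, MDP.isStrategy_mdStrat (isMD_subsetChoice P), bisimilar_of_subset_sum_eq hT hP⟩
  · rintro ⟨α, hα, h⟩
    exact exists_subset_sum_eq_of_bisimilar hT hα h
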